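/- arXiv:1007.4776 — 2 statements merged into one kernel-verified Lean document; each statement's English description precedes it below -/
import Mathlib

section
/- Let R be a commutative noetherian ring and let A be a finite partially ordered set, regarded as a category (the paper states this for an arbitrary finite direct category). Let Z be a bounded cochain complex in the abelian functor category of functors A → Mod R, all of whose values Z^m(a) are finitely generated R-modules. If for every a ∈ A the complex of R-modules Z(a) obtained by evaluation at a is isomorphic, in the derived category of R-modules, to a bounded cochain complex of finitely generated projective R-modules, then Z is isomorphic, in the derived category of the functor category A → Mod R, to a bounded cochain complex of functors each of whose values is a finitely generated projective R-module. -/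
open CategoryTheory Limits

/-- Two cochain complexes are isomorphic in the derived category of an abelian category
if and only if they are connected by a roof of quasi-isomorphisms `K₁ ⟵ W ⟶ K₂`. We use this
as the definition of "isomorphic in the derived category". -/
def DerivedIso {C : Type*} [Category C] [Abelian C]
    (K₁ K₂ : CochainComplex C ℤ) : Prop :=
  ∃ (W : CochainComplex C ℤ) (f : W ⟶ K₁) (g : W ⟶ K₂), QuasiIso f ∧ QuasiIso g

section StepAux
open HomologicalComplex

lemma aux_rel (n : ℤ) : (ComplexShape.up ℤ).Rel (n - 1) n := by simp

variable {C : Type*} [Category C] [Abelian C]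

noncomputable abbrev dsk (n : ℤ) (X : C) : CochainComplex C ℤ :=
  double (𝟙 X) (aux_rel n)

lemma dsk_acyclic (n : ℤ) (X : C) : (dsk n X).Acyclic := by
  intro i
  rw [exactAt_iff' _ (i-1) i (i+1) (by simp) (by simp)]
  by_cases h0 : i = n - 1
  · obtain rfl : n = i + 1 := by lia
    refine (ShortComplex.exact_iff_mono _ ?_).2 ?_
    · exact double_d_eq_zero₁ _ (aux_rel (i+1)) _ _ (by lia)
    · have := double_d (𝟙 X) (aux_rel (i+1)) (by lia)
      have e : ∀ j (hj : j = i + 1 - 1), Mono ((dsk (i+1) X).d j (i+1)) := by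
        rintro j rfl
        rw [this]; infer_instance
      exact e i (by lia)
  · by_cases h1 : i = n
    · subst h1
      refine (ShortComplex.exact_iff_epi _ ?_).2 ?_
      · exact double_d_eq_zero₀ _ (aux_rel i) _ _ (by lia)
      · have := double_d (𝟙 X) (aux_rel i) (by lia)
        have e : Epi ((dsk i X).d (i-1) i) := by
          rw [this]; infer_instance
        exact e
    · exact ShortComplex.exact_of_isZero_X₂ _ (isZero_double_X (𝟙 X) (aux_rel n) _ h0 h1)

noncomputable def dskMap (n : ℤ) {X Y : C} (p : X ⟶ Y) : dsk n X ⟶ dsk n Y :=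
  mkHomFromDouble (aux_rel n) (by lia) (p ≫ (doubleXIso₀ (𝟙 Y) (aux_rel n)).inv)
    (p ≫ (doubleXIso₁ (𝟙 Y) (aux_rel n) (by lia)).inv) (by
      rw [double_d _ _ (by lia)]; simp) (fun k _ => by
      rw [double_d_eq_zero₀ _ _ _ _ (by lia)]; simp)

open scoped Classical in
noncomputable def toDsk (Y : CochainComplex C ℤ) (n : ℤ) : Y ⟶ dsk n (Y.X n) where
  f k :=
    if hk₀ : k = n - 1 then
      Y.d k n ≫ (doubleXIso₀ (𝟙 (Y.X n)) (aux_rel n)).inv ≫ eqToHom (by rw [hk₀])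
    else if hk₁ : k = n then
      eqToHom (by rw [hk₁]) ≫ (doubleXIso₁ (𝟙 (Y.X n)) (aux_rel n) (by lia)).inv ≫ eqToHom (by rw [hk₁])
    else 0
  comm' i j hij := by
    by_cases hj : j = n
    · subst hj
      obtain rfl : i = j - 1 := by simp at hij; lia
      rw [dif_pos rfl, dif_neg (by lia), dif_pos rfl, double_d _ _ (by lia)]
      simp
    · by_cases hj' : j = n - 1
      · subst hj'
        rw [double_d_eq_zero₁ _ _ _ _ hj, dif_pos rfl]
        simp
      · exact (isZero_double_X _ _ _ hj' hj).eq_of_tgt _ _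

instance (Y : CochainComplex C ℤ) (n : ℤ) : IsIso ((toDsk Y n).f n) := by
  dsimp [toDsk]
  rw [dif_neg (by lia), if_pos rfl]
  infer_instance

lemma dskMap_epi (n : ℤ) {X Y : C} (p : X ⟶ Y) [Epi p] : Epi (dskMap n p) := by
  apply epi_of_epi_f
  intro i
  by_cases h0 : i = n - 1
  · subst h0
    simp only [dskMap, mkHomFromDouble_f₀]
    exact epi_comp _ _
  · by_cases h1 : i = n
    · subst h1
      simp only [dskMap, mkHomFromDouble_f₁]
      exact epi_comp _ _
    · exact (isZero_double_X _ _ _ h0 h1).epi _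

lemma quasiIso_of_epi_acyclic_kernel {K L : CochainComplex C ℤ} (f : K ⟶ L) [Epi f]
    (h : (kernel f).Acyclic) : QuasiIso f := by
  have hS : (ShortComplex.mk (kernel.ι f) f (by simp)).ShortExact :=
    { exact := ShortComplex.exact_kernel f }
  have hz (i) : IsZero ((kernel f).homology i) := (h i).isZero_homology
  rw [quasiIso_iff]
  intro i
  rw [quasiIsoAt_iff_isIso_homologyMap]
  have h2 := hS.homology_exact₂ i
  have h3 := hS.homology_exact₃ i (i+1) (by simp)
  have : Mono (homologyMap f i) := h2.mono_g ((hz i).eq_of_src _ _)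
  have : Epi (homologyMap f i) := h3.epi_f ((hz (i+1)).eq_of_tgt _ _)
  exact isIso_of_mono_of_epi _

lemma acyclic_kernel {K L : CochainComplex C ℤ} (f : K ⟶ L) [Epi f] (hK : K.Acyclic)
    (hL : L.Acyclic) : (kernel f).Acyclic := by
  have hS : (ShortComplex.mk (kernel.ι f) f (by simp)).ShortExact :=
    { exact := ShortComplex.exact_kernel f }
  refine hS.acyclic_X₁ ?_
  rw [quasiIso_iff]
  intro i
  exact (quasiIsoAt_iff_exactAt _ _ (hK i)).2 (hL i)

lemma res_step (Y : CochainComplex C ℤ) (n : ℤ) {Q : C} (p : Q ⟶ Y.X n) [Epi p] :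
    ∃ (Y' : CochainComplex C ℤ) (f : Y' ⟶ Y), QuasiIso f ∧ Nonempty (Y'.X n ≅ Q) ∧
      (∀ m, m ≠ n → m ≠ n - 1 → IsIso (f.f m)) ∧
      ∃ s : Y'.X (n - 1) ⟶ Q, Mono (biprod.lift (f.f (n-1)) s) := by
  have hp := dskMap_epi n p
  have sq := IsPullback.of_hasPullback (toDsk Y n) (dskMap n p)
  have sqm (m : ℤ) : IsPullback ((pullback.fst (toDsk Y n) (dskMap n p)).f m)
      ((pullback.snd (toDsk Y n) (dskMap n p)).f m) ((toDsk Y n).f m) ((dskMap n p).f m) := sq.map (HomologicalComplex.eval C (ComplexShape.up ℤ) m)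
  refine ⟨pullback (toDsk Y n) (dskMap n p), pullback.fst _ _, ?_, ?_, ?_, ?_⟩
  · apply quasiIso_of_epi_acyclic_kernel
    have := isIso_kernel_map_of_isPullback sq
    have h := acyclic_kernel (dskMap n p) (dsk_acyclic n Q) (dsk_acyclic n _)
    intro i
    exact (h i).of_iso (asIso (kernel.map _ _ _ _ sq.w)).symm
  · have h : IsIso ((toDsk Y n).f n) := inferInstance
    have : IsIso ((pullback.snd (toDsk Y n) (dskMap n p)).f n) :=
      MorphismProperty.of_isPullback (P := MorphismProperty.isomorphisms C) (sqm n) h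
    exact ⟨asIso ((pullback.snd (toDsk Y n) (dskMap n p)).f n) ≪≫ doubleXIso₁ _ _ (by lia)⟩
  · intro m h1 h2
    have : IsIso ((dskMap n p).f m) :=
      ⟨0, (isZero_double_X _ _ _ h2 h1).eq_of_src _ _, (isZero_double_X _ _ _ h2 h1).eq_of_src _ _⟩
    exact MorphismProperty.of_isPullback (P := MorphismProperty.isomorphisms C) (sqm m).flip this
  · refine ⟨(pullback.snd (toDsk Y n) (dskMap n p)).f (n-1) ≫ (doubleXIso₀ _ _).hom, ?_⟩
    refine Preadditive.mono_of_cancel_zero _ fun {T} g hg => ?_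
    have h1 := hg =≫ biprod.fst
    have h2 := hg =≫ biprod.snd
    simp only [Category.assoc, biprod.lift_fst, biprod.lift_snd, zero_comp] at h1 h2
    refine (sqm (n-1)).hom_ext ?_ ?_
    · rw [h1, zero_comp]
    · rw [← cancel_mono (doubleXIso₀ (𝟙 Q) (aux_rel n)).hom]
      rw [Category.assoc, h2]; simp
end StepAux
section ProjAux
open HomologicalComplex

variable {C : Type*} [Category C] [Abelian C]

lemma opc_shortExact (E : CochainComplex C ℤ) (n : ℤ) (h : E.ExactAt n) :
    (ShortComplex.mk (E.fromOpcycles n (n+1)) (E.pOpcycles (n+1)) (by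
      rw [← cancel_epi (E.pOpcycles n)]; simp)).ShortExact := by
  have h1 : (ShortComplex.mk (E.d n (n+1)) (E.pOpcycles (n+1)) (by simp)).Exact :=
    ShortComplex.exact_of_g_is_cokernel _ (E.opcyclesIsCokernel n (n+1) (by simp))
  have hm : Mono (E.fromOpcycles n (n+1)) := by
    have : (ShortComplex.mk (E.homologyι n) (E.fromOpcycles n (n+1)) (by simp)).Exact :=
      ShortComplex.exact_of_f_is_kernel _ (E.homologyIsKernel n (n+1) (by simp))
    exact this.mono_g (h.isZero_homology.eq_of_src _ _)
  refine { exact := ?_, mono_f := hm, epi_g := inferInstanceAs (Epi (E.pOpcycles (n+1))) }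
  let φ : (ShortComplex.mk (E.d n (n+1)) (E.pOpcycles (n+1)) (by simp)) ⟶
    (ShortComplex.mk (E.fromOpcycles n (n+1)) (E.pOpcycles (n+1)) (by
      rw [← cancel_epi (E.pOpcycles n)]; simp)) :=
    { τ₁ := E.pOpcycles n, τ₂ := 𝟙 _, τ₃ := 𝟙 _ }
  have : Epi φ.τ₁ := inferInstanceAs (Epi (E.pOpcycles n))
  have : IsIso φ.τ₂ := inferInstanceAs (IsIso (𝟙 _))
  have : Mono φ.τ₃ := inferInstanceAs (Mono (𝟙 _))
  exact (ShortComplex.exact_iff_of_epi_of_isIso_of_mono φ).1 h1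

lemma opc_projective (E : CochainComplex C ℤ) (hE : E.Acyclic) (b : ℤ)
    (hb : ∀ m, b < m → IsZero (E.X m)) (k : ℕ) : ∀ (n : ℤ), b < n + k →
    (∀ m, n < m → Projective (E.X m)) → Projective (E.opcycles n) := by
  induction k with
  | zero =>
    intro n hn _
    have hz : IsZero (E.opcycles n) := by
      rw [IsZero.iff_id_eq_zero, ← cancel_epi (E.pOpcycles n)]
      exact (hb n (by simpa using hn)).eq_of_src _ _
    exact hz.projective
  | succ k ih =>
    intro n hn hp
    have h1 := ih (n+1) (by push_cast at hn; lia) (fun m hm => hp m (by lia))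
    have hS := opc_shortExact E n (hE n)
    have : Projective (ShortComplex.mk (E.fromOpcycles n (n+1)) (E.pOpcycles (n+1)) (by
      rw [← cancel_epi (E.pOpcycles n)]; simp)).X₃ := h1
    have hs := hS.splittingOfProjective
    have : Projective (E.X (n+1)) := hp _ (by lia)
    exact Retract.projective (⟨E.fromOpcycles n (n+1), hs.r, hs.f_r⟩ : Retract _ (E.X (n+1)))

open DerivedCategory in
attribute [local instance] HasDerivedCategory.standard in
lemma lift_qis {K L W Y : CochainComplex C ℤ} (f : W ⟶ K) (g : W ⟶ L) (p : Y ⟶ K)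
    [QuasiIso f] [QuasiIso g] [QuasiIso p] [L.IsKProjective] :
    ∃ s : L ⟶ Y, QuasiIso s := by
  obtain ⟨h, hh⟩ := (CochainComplex.IsKProjective.Qh_map_bijective L
    ((HomotopyCategory.quotient C (.up ℤ)).obj Y)).surjective
      ((quotientCompQhIso C).hom.app L ≫ (inv (Q.map g) ≫ Q.map f ≫ inv (Q.map p)) ≫
        (quotientCompQhIso C).inv.app Y)
  obtain ⟨s, rfl⟩ := (HomotopyCategory.quotient C (.up ℤ)).map_surjective h
  refine ⟨s, ?_⟩
  rw [← isIso_Q_map_iff_quasiIso]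
  have := quotientCompQhIso_hom_naturality s
  rw [hh] at this
  simp only [Category.assoc, Iso.inv_hom_id_app, Category.comp_id] at this
  rw [cancel_epi] at this
  rw [← this]
  infer_instance

open DerivedCategory in
attribute [local instance] HasDerivedCategory.standard in
lemma cone_acyclic {L Y : CochainComplex C ℤ} (s : L ⟶ Y) [QuasiIso s] :
    (CochainComplex.mappingCone s).Acyclic := by
  have h1 : HomotopyCategory.quasiIso C _ ((HomotopyCategory.quotient C _).map s) := by
    rw [HomotopyCategory.quotient_map_mem_quasiIso_iff]
    rwa [mem_quasiIso_iff]
  rw [HomotopyCategory.quasiIso_eq_trW_subcategoryAcyclic] at h1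
  have h2 := (ObjectProperty.trW_iff_of_distinguished (HomotopyCategory.subcategoryAcyclic C) _
    (HomotopyCategory.mappingCone_triangleh_distinguished s)).1 h1
  exact (HomotopyCategory.quotient_obj_mem_subcategoryAcyclic_iff_acyclic _).1 h2

lemma opc_projective_of_qis {L Y : CochainComplex C ℤ} (s : L ⟶ Y) [QuasiIso s] (b c : ℤ)
    (hL : ∀ m, (m < c ∨ b < m) → IsZero (L.X m)) (hLp : ∀ m, Projective (L.X m))
    (hY : ∀ m, b < m → IsZero (Y.X m)) (n : ℤ) (hn : n + 1 < c)
    (hYp : ∀ m, n < m → Projective (Y.X m)) : Projective (Y.opcycles n) := by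
  have hX (m : ℤ) := homotopyCofiber.XIsoBiprod s m (m+1) (by simp)
  have h1 : Projective ((CochainComplex.mappingCone s).opcycles n) := by
    refine opc_projective _ (cone_acyclic s) b (fun m hm => ?_) (b - n + 1).toNat n (by lia)
      (fun m hm => ?_)
    · refine IsZero.of_iso ?_ (hX m)
      rw [biprod_isZero_iff]
      exact ⟨hL _ (by lia), hY _ hm⟩
    · have := hYp m hm
      have := hLp (m+1)
      exact Projective.of_iso (hX m).symm inferInstance
  have hi (m : ℤ) (hm : m + 1 < c) : IsIso ((CochainComplex.mappingCone.inr s).f m) := by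
    refine ⟨(CochainComplex.mappingCone.snd s).v m m (add_zero m), by simp, ?_⟩
    have h := CochainComplex.mappingCone.id_X s m (m+1) rfl
    have hz : (CochainComplex.mappingCone.fst s).1.v m (m+1) rfl = 0 :=
      (hL (m+1) (Or.inl hm)).eq_of_tgt _ _
    rw [hz, zero_comp, zero_add] at h
    exact h
  have : IsIso (opcyclesMap (CochainComplex.mappingCone.inr s) n) := by
    have h := hi n hn
    have h' := hi (n-1) (by lia)
    let φ := ((shortComplexFunctor C _ n).map (CochainComplex.mappingCone.inr s))
    have : IsIso φ.τ₂ := h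
    have : IsIso φ.τ₁ := by
      have e : ∀ j, j = n - 1 → IsIso ((CochainComplex.mappingCone.inr s).f j) := by
        rintro j rfl; exact h'
      exact e _ (by simp)
    exact inferInstanceAs (IsIso (ShortComplex.opcyclesMap φ))
  exact Projective.of_iso (asIso (opcyclesMap (CochainComplex.mappingCone.inr s) n)).symm h1
end ProjAux
section CoverAux
universe u
variable {R : Type} [CommRing R] {A : Type} [PartialOrder A] [Fintype A]

def covT (n : A → ℕ) (b : A) : Type u := ULift.{u} (Σ a : {a : A // a ≤ b}, Fin (n a.1))

def covMap (n : A → ℕ) {b c : A} (h : b ≤ c) : covT.{u} n b → covT.{u} n c :=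
  fun t => ⟨⟨⟨t.down.1.1, t.down.1.2.trans h⟩, t.down.2⟩⟩

instance (n : A → ℕ) (b : A) : Finite (covT.{u} n b) := by
  unfold covT; infer_instance

noncomputable def covF (R : Type) [CommRing R] (n : A → ℕ) : A ⥤ ModuleCat.{u} R where
  obj b := ModuleCat.of R (covT.{u} n b →₀ R)
  map f := ModuleCat.ofHom (Finsupp.lmapDomain R R (covMap n f.le))
  map_id b := by
    ext : 1
    exact Finsupp.lmapDomain_id R R
  map_comp f g := by
    ext : 1
    exact Finsupp.lmapDomain_comp R R (covMap n f.le) (covMap n g.le)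

def GoodF (F : A ⥤ ModuleCat.{u} R) : Prop :=
  ∀ a, Module.Finite R (F.obj a) ∧ Module.Projective R (F.obj a)

lemma goodF_cov (n : A → ℕ) : GoodF (covF.{u} R n) := by
  intro a
  exact ⟨inferInstanceAs (Module.Finite R (covT.{u} n a →₀ R)),
    inferInstanceAs (Module.Projective R (covT.{u} n a →₀ R))⟩

lemma exists_cover (F : A ⥤ ModuleCat.{u} R) (hF : ∀ a, Module.Finite R (F.obj a)) :
    ∃ (Q : A ⥤ ModuleCat.{u} R) (p : Q ⟶ F), GoodF Q ∧ Epi p := by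
  have h (a : A) := (Module.Finite.exists_fin (R := R) (M := F.obj a))
  choose n g hg using h
  let v (b : A) : covT.{u} n b → F.obj b :=
    fun t => F.map (homOfLE t.down.1.2) (g t.down.1.1 t.down.2)
  let p : covF.{u} R n ⟶ F :=
    { app := fun b => ModuleCat.ofHom (Finsupp.linearCombination R (v b))
      naturality := by
        intro b c f
        ext : 1
        refine Finsupp.lhom_ext' fun t => LinearMap.ext_ring ?_
        change Finsupp.linearCombination R (v c) (Finsupp.mapDomain (covMap n f.le)
          (Finsupp.single t 1)) = F.map f (Finsupp.linearCombination R (v b) (Finsupp.single t 1))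
        rw [Finsupp.mapDomain_single, Finsupp.linearCombination_single,
          Finsupp.linearCombination_single, one_smul, one_smul]
        change F.map _ _ = F.map f (F.map _ _)
        rw [← ConcreteCategory.comp_apply, ← F.map_comp]
        rfl }
  refine ⟨covF R n, p, goodF_cov n, ?_⟩
  rw [NatTrans.epi_iff_epi_app]
  intro b
  rw [ModuleCat.epi_iff_surjective]
  change Function.Surjective (Finsupp.linearCombination R (v b))
  rw [← LinearMap.range_eq_top, Finsupp.range_linearCombination, eq_top_iff, ← hg b,
    Submodule.span_le]
  rintro _ ⟨i, rfl⟩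
  refine Submodule.subset_span ⟨⟨⟨⟨b, le_rfl⟩, i⟩⟩, ?_⟩
  change F.map (𝟙 b) _ = _
  simp

lemma GoodF.of_iso {F G : A ⥤ ModuleCat.{u} R} (e : F ≅ G) (h : GoodF F) : GoodF G := by
  intro a
  have := (h a).1
  have := (h a).2
  let e' := (e.app a).toLinearEquiv
  exact ⟨Module.Finite.equiv e', Module.Projective.of_equiv e'⟩

lemma finF_of_iso {F G : A ⥤ ModuleCat.{u} R} (e : F ≅ G)
    (h : ∀ a, Module.Finite R (F.obj a)) : ∀ a, Module.Finite R (G.obj a) := by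
  intro a
  have := h a
  exact Module.Finite.equiv (e.app a).toLinearEquiv

lemma finF_of_mono [IsNoetherianRing R] {F G H : A ⥤ ModuleCat.{u} R} (f : F ⟶ G) (s : F ⟶ H)
    [Mono (biprod.lift f s)]
    (hG : ∀ a, Module.Finite R (G.obj a)) (hH : ∀ a, Module.Finite R (H.obj a)) :
    ∀ a, Module.Finite R (F.obj a) := by
  intro a
  have := hG a
  have := hH a
  have hm : Function.Injective ((biprod.lift f s).app a) := by
    rw [← ModuleCat.mono_iff_injective]
    infer_instance
  have e : (biprod.lift f s).app a = f.app a ≫ (biprod.inl : G ⟶ G ⊞ H).app a +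
      s.app a ≫ (biprod.inr : H ⟶ G ⊞ H).app a := by
    rw [biprod.lift_eq]; rfl
  refine Module.Finite.of_injective ((f.app a).hom.prod (s.app a).hom) ?_
  rw [injective_iff_map_eq_zero]
  intro x hx
  have h1 : (f.app a).hom x = 0 := congrArg Prod.fst hx
  have h2 : (s.app a).hom x = 0 := congrArg Prod.snd hx
  apply hm
  rw [map_zero, e]
  simp [h1, h2]

lemma goodF_zero {F : A ⥤ ModuleCat.{u} R} (h : IsZero F) : GoodF F := by
  intro a
  have : Subsingleton (F.obj a) := by
    apply ModuleCat.subsingleton_of_isZero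
    exact h.obj a
  exact ⟨inferInstance, inferInstance⟩

lemma exists_res [IsNoetherianRing R] (Z : CochainComplex (A ⥤ ModuleCat.{u} R) ℤ) (b : ℤ)
    (hb : ∀ m, b < m → IsZero (Z.X m)) (hZ : ∀ m a, Module.Finite R ((Z.X m).obj a)) (k : ℕ) :
    ∃ (Y : CochainComplex (A ⥤ ModuleCat.{u} R) ℤ) (f : Y ⟶ Z), QuasiIso f ∧
      (∀ m a, Module.Finite R ((Y.X m).obj a)) ∧ (∀ m, b < m → IsZero (Y.X m)) ∧
      ∀ m, b - k < m → GoodF (Y.X m) := by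
  induction k with
  | zero => exact ⟨Z, 𝟙 _, inferInstance, hZ, hb, fun m hm => goodF_zero (hb m (by simpa using hm))⟩
  | succ k ih =>
    obtain ⟨Y, f, hf, hfin, hz, hgood⟩ := ih
    obtain ⟨Q, p, hQ, hp⟩ := exists_cover (Y.X (b - k)) (hfin _)
    obtain ⟨Y', g, hg, ⟨e⟩, hi, s, hs⟩ := res_step Y (b - k) p
    refine ⟨Y', g ≫ f, inferInstance, ?_, ?_, ?_⟩
    · intro m
      by_cases h1 : m = b - k
      · subst h1
        exact finF_of_iso e.symm (fun a => (hQ a).1)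
      by_cases h2 : m = b - k - 1
      · subst h2
        exact finF_of_mono (g.f _) s (hfin _) (fun a => (hQ a).1)
      have := hi m h1 h2
      exact finF_of_iso (asIso (g.f m)).symm (hfin m)
    · intro m hm
      have := hi m (by lia) (by lia)
      exact (hz m hm).of_iso (asIso (g.f m))
    · intro m hm
      by_cases h1 : m = b - k
      · subst h1
        exact hQ.of_iso e.symm
      have := hi m h1 (by push_cast at hm; lia)
      exact (hgood m (by push_cast at hm; lia)).of_iso (asIso (g.f m)).symm

end CoverAux
/-- Let `R` be a commutative noetherian ring and `A` a finite partially
ordered set, regarded as a category.  Let `Z` be a bounded cochain complex in the functor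
category `A ⥤ Mod R` all of whose values are finitely generated `R`-modules.  If for every
`a ∈ A` the evaluation `Z(a)` is isomorphic, in the derived category of `R`-modules, to a
bounded complex of finitely generated projective `R`-modules, then `Z` is isomorphic, in the
derived category of `A ⥤ Mod R`, to a bounded complex of functors all of whose values are
finitely generated projective `R`-modules. -/
theorem perfect_of_pointwise_perfect
    (R : Type) [CommRing R] [IsNoetherianRing R]
    (A : Type) [PartialOrder A] [Fintype A]
    (Z : CochainComplex (A ⥤ ModuleCat R) ℤ)
    (hZbdd : ∃ a b : ℤ, ∀ m : ℤ, (m < a ∨ b < m) → IsZero (Z.X m))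
    (hZfin : ∀ (m : ℤ) (a : A), Module.Finite R ((Z.X m).obj a))
    (hpointwise : ∀ a : A, ∃ P : CochainComplex (ModuleCat R) ℤ,
      (∃ c d : ℤ, ∀ m : ℤ, (m < c ∨ d < m) → IsZero (P.X m)) ∧
      (∀ m : ℤ, Module.Finite R (P.X m) ∧ Module.Projective R (P.X m)) ∧
      DerivedIso ((((evaluation A (ModuleCat R)).obj a).mapHomologicalComplex
        (ComplexShape.up ℤ)).obj Z) P) :
    ∃ Q : CochainComplex (A ⥤ ModuleCat R) ℤ,
      (∃ c d : ℤ, ∀ m : ℤ, (m < c ∨ d < m) → IsZero (Q.X m)) ∧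
      (∀ (m : ℤ) (a : A), Module.Finite R ((Q.X m).obj a) ∧
        Module.Projective R ((Q.X m).obj a)) ∧
      DerivedIso Z Q := by
  obtain ⟨z, b, hb⟩ := hZbdd
  choose P hP hPp hPd using hpointwise
  choose c d hcd using hP
  obtain ⟨N, hNz, hNb, hNc⟩ : ∃ N : ℤ, N ≤ z ∧ N < b ∧ ∀ a, N + 1 < c a := by
    obtain ⟨M, hM⟩ := (Set.finite_range c).bddBelow
    refine ⟨min (min z (b - 1)) (M - 2), by lia, by lia, fun a => ?_⟩
    have := hM ⟨a, rfl⟩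
    lia
  obtain ⟨Y, p, hp, hfin, hYz, hgood⟩ := exists_res Z b (fun m hm => hb m (Or.inr hm)) hZfin
    (b - N).toNat
  replace hgood : ∀ m, N < m → GoodF (Y.X m) := fun m hm => hgood m (by lia)
  have hGE : Y.IsGE N := by
    rw [CochainComplex.isGE_iff]
    intro i hi
    rw [exactAt_iff_of_quasiIsoAt p i]
    exact ShortComplex.exact_of_isZero_X₂ _ (hb i (Or.inl (by lia)))
  have hopc : GoodF (Y.opcycles N) := by
    intro a
    refine ⟨?_, ?_⟩
    · have := hfin N a
      have hs : Function.Surjective ((Y.pOpcycles N).app a) := by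
        rw [← ModuleCat.epi_iff_surjective]
        infer_instance
      exact Module.Finite.of_surjective ((Y.pOpcycles N).app a).hom hs
    · let F := (evaluation A (ModuleCat R)).obj a
      let Ya := (F.mapHomologicalComplex (ComplexShape.up ℤ)).obj Y
      have hPj (m : ℤ) : Projective ((P a).X m) :=
        (IsProjective.iff_projective ((P a).X m)).1 (hPp a m).2
      obtain ⟨W, f, g, hf, hg⟩ := hPd a
      have hLE : (P a).IsStrictlyLE (d a) := by
        rw [CochainComplex.isStrictlyLE_iff]
        exact fun i hi => hcd a i (Or.inr hi)
      have hK := CochainComplex.isKProjective_of_projective (P a) (d a)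
      obtain ⟨s, hs⟩ := lift_qis f g ((F.mapHomologicalComplex (ComplexShape.up ℤ)).map p)
      have hproj : Projective (Ya.opcycles N) := by
        refine opc_projective_of_qis s (max b (d a)) (c a) (fun m hm => hcd a m (by lia)) hPj
          (fun m hm => (hYz m (by lia)).obj a) N (hNc a) (fun m hm => ?_)
        exact (IsProjective.iff_projective ((Y.X m).obj a)).1 (hgood m hm a).2
      have e : Ya.opcycles N ≅ F.obj (Y.opcycles N) := (Y.sc N).mapOpcyclesIso F
      have := Projective.of_iso e hproj
      exact (IsProjective.iff_projective ((Y.opcycles N).obj a)).2 this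
  have htr : ∀ m, GoodF ((Y.truncGE N).X m) := by
    intro m
    rcases lt_trichotomy m N with h | rfl | h
    · exact goodF_zero (CochainComplex.isZero_of_isStrictlyGE _ N m h)
    · exact hopc.of_iso (CochainComplex.truncGEXIsoOpcycles Y m).symm
    · exact (hgood m h).of_iso (CochainComplex.truncGEXIso Y N m h).symm
  refine ⟨Y.truncGE N, ⟨N, b, ?_⟩, htr, ⟨Y, p, Y.πTruncGE N, hp, ?_⟩⟩
  · rintro m (h | h)
    · exact CochainComplex.isZero_of_isStrictlyGE _ N m h
    · exact (hYz m h).of_iso (CochainComplex.truncGEXIso Y N m (by lia))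
  · rw [CochainComplex.quasiIso_πTruncGE_iff]
    exact hGE
end

section
/- Let R be a commutative noetherian ring and let A be a finite partially ordered set, regarded as a category. For every bounded cochain complex Z in the functor category A → Mod R all of whose values are finitely generated R-modules, there exist a bounded above cochain complex Q in A → Mod R all of whose values are finitely generated projective R-modules and a pointwise quasi-isomorphism Q → Z. -/
open CategoryTheory Limits

namespace PtwiseRes

section Abstract

universe v u
variable {C : Type u} [Category.{v} C] [Abelian C]

/-- Stage `n` of the construction of the resolution. -/
structure St (N P : ObjectProperty C) (Z : ChainComplex C ℕ) (n : ℕ) where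
  Q : C
  K : C
  i : K ⟶ Q
  f : Q ⟶ Z.X n
  hK : N K
  hQ : P Q
  mono : Mono i
  surj : ∀ ⦃T : C⦄ (z : T ⟶ Z.X n), z ≫ Z.d n ((ComplexShape.down ℕ).next n) = 0 →
    ∃ (T' : C) (π : T' ⟶ T) (_ : Epi π) (x : T' ⟶ K), π ≫ z = x ≫ i ≫ f

variable {N P : ObjectProperty C} {Z : ChainComplex C ℕ}

/-- The differential between consecutive stages. -/
structure Link {n : ℕ} (S : St N P Z n) (S' : St N P Z (n + 1)) where
  p : S'.Q ⟶ pullback (S.i ≫ S.f) (Z.d (n + 1) n)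
  epi : Epi p
  fac : p ≫ pullback.snd _ _ = S'.f
  ker : S'.i ≫ p ≫ pullback.fst _ _ = 0
  lift : ∀ ⦃T : C⦄ (x : T ⟶ S'.Q), x ≫ p ≫ pullback.fst _ _ = 0 → ∃ k : T ⟶ S'.K, k ≫ S'.i = x

lemma exists_step
    (hpull : ∀ ⦃X Y W : C⦄ (f : X ⟶ W) (g : Y ⟶ W), N X → N Y → N (pullback f g))
    (hker : ∀ ⦃X Y : C⦄ (f : X ⟶ Y), N X → N (kernel f))
    (hPN : ∀ X, P X → N X)
    (hcov : ∀ X, N X → ∃ (Y : C) (_ : P Y) (p : Y ⟶ X), Epi p)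
    (hZ : ∀ n, N (Z.X n)) {n : ℕ} (S : St N P Z n) :
    ∃ S' : St N P Z (n + 1), Nonempty (Link S S') := by
  obtain ⟨Y, hY, p, hp⟩ := hcov _ (hpull (S.i ≫ S.f) (Z.d (n + 1) n) S.hK (hZ _))
  refine ⟨{ Q := Y, K := kernel (p ≫ pullback.fst _ _), i := kernel.ι _,
            f := p ≫ pullback.snd _ _, hK := hker _ (hPN _ hY), hQ := hY, mono := inferInstance,
            surj := ?_ }, ⟨{ p := p, epi := hp, fac := rfl, ker := kernel.condition _, lift := ?_ }⟩⟩
  · intro T z hz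
    rw [ChainComplex.next_nat_succ] at hz
    obtain ⟨T', π, hπ, x, hx⟩ := surjective_up_to_refinements_of_epi p
      (pullback.lift (f := S.i ≫ S.f) (g := Z.d (n + 1) n) 0 z (by simp [hz]))
    refine ⟨T', π, hπ, kernel.lift _ x ?_, ?_⟩
    · rw [← Category.assoc, ← hx, Category.assoc, pullback.lift_fst, comp_zero]
    · rw [kernel.lift_ι_assoc, ← Category.assoc, ← hx, Category.assoc, pullback.lift_snd]
  · intro T x hx
    exact ⟨kernel.lift _ x hx, by simp⟩

lemma exists_zero
    (hPN : ∀ X, P X → N X)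
    (hcov : ∀ X, N X → ∃ (Y : C) (_ : P Y) (p : Y ⟶ X), Epi p)
    (hZ : ∀ n, N (Z.X n)) :
    ∃ S : St N P Z 0, IsIso S.i := by
  obtain ⟨Y, hY, p, hp⟩ := hcov _ (hZ 0)
  refine ⟨{ Q := Y, K := Y, i := 𝟙 _, f := p, hK := hPN _ hY, hQ := hY, mono := inferInstance,
            surj := ?_ }, by dsimp; infer_instance⟩
  intro T z _
  obtain ⟨T', π, hπ, x, hx⟩ := surjective_up_to_refinements_of_epi p z
  exact ⟨T', π, hπ, x, by simpa using hx⟩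

theorem exists_chain
    (hpull : ∀ ⦃X Y W : C⦄ (f : X ⟶ W) (g : Y ⟶ W), N X → N Y → N (pullback f g))
    (hker : ∀ ⦃X Y : C⦄ (f : X ⟶ Y), N X → N (kernel f))
    (hPN : ∀ X, P X → N X)
    (hcov : ∀ X, N X → ∃ (Y : C) (_ : P Y) (p : Y ⟶ X), Epi p)
    (hZ : ∀ n, N (Z.X n)) :
    ∃ (Q : ChainComplex C ℕ) (f : Q ⟶ Z), (∀ n, P (Q.X n)) ∧ QuasiIso f := by
  obtain ⟨S0, hS0⟩ := exists_zero (P := P) hPN hcov hZ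
  choose next hnext using fun (n : ℕ) (S : St N P Z n) => exists_step hpull hker hPN hcov hZ S
  let S : ∀ n, St N P Z n := fun n => Nat.rec S0 (fun n s => next n s) n
  have L : ∀ n, Link (S n) (S (n + 1)) := fun n => (hnext n (S n)).some
  have hS0 : IsIso (S 0).i := hS0
  clear_value S
  let d : ∀ n, (S (n + 1)).Q ⟶ (S n).Q := fun n => (L n).p ≫ pullback.fst _ _ ≫ (S n).i
  have hd : ∀ n, d (n + 1) ≫ d n = 0 := fun n => by
    have := (L n).ker
    simp only [d, Category.assoc]
    rw [reassoc_of% this]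
    simp
  let Q := ChainComplex.of (fun n => (S n).Q) d hd
  have hQd : ∀ n, Q.d (n + 1) n = d n := fun n => ChainComplex.of_d (fun n => (S n).Q) d n
  let f : Q ⟶ Z := ChainComplex.ofHom (fun n => (S n).f) (fun n => by
    rw [hQd, ← (L n).fac]
    simp only [d, Category.assoc]
    rw [← pullback.condition])
  have hf : ∀ n, f.f n = (S n).f := fun n => rfl
  have hfac : ∀ n ⦃T : C⦄ (x : T ⟶ (S n).Q), x ≫ Q.d n ((ComplexShape.down ℕ).next n) = 0 →
      ∃ k : T ⟶ (S n).K, k ≫ (S n).i = x := by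
    intro n T x hx
    cases n with
    | zero => exact ⟨x ≫ inv (S 0).i, by simp⟩
    | succ n =>
      rw [ChainComplex.next_nat_succ, hQd] at hx
      have := (S n).mono
      refine (L n).lift x ?_
      rw [← cancel_mono (S n).i]
      simpa [d] using hx
  have hcyc : ∀ n, (S n).i ≫ Q.d n ((ComplexShape.down ℕ).next n) = 0 := by
    intro n
    cases n with
    | zero => rw [Q.shape _ _ (by simp)]; simp
    | succ n =>
      rw [ChainComplex.next_nat_succ, hQd]
      have := (L n).ker
      simp only [d]
      rw [reassoc_of% this]; simp
  refine ⟨Q, f, fun n => (S n).hQ, ⟨fun n => ?_⟩⟩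
  rw [quasiIsoAt_iff_isIso_homologyMap]
  have h1 : Mono (HomologicalComplex.homologyMap f n) := by
    rw [HomologicalComplex.mono_homologyMap_iff_up_to_refinements f (n + 1) n _ (by simp) rfl]
    intro T x hx y hy
    obtain ⟨k, rfl⟩ := hfac n x hx
    have := (L n).epi
    obtain ⟨T', π, hπ, x', hx'⟩ := surjective_up_to_refinements_of_epi (L n).p
      (pullback.lift (f := (S n).i ≫ (S n).f) (g := Z.d (n + 1) n) k y (by
        rw [← hy, hf, Category.assoc]))
    refine ⟨T', π, hπ, x', ?_⟩
    rw [hQd]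
    simp only [d]
    rw [← reassoc_of% hx', pullback.lift_fst_assoc]
  have h2 : Epi (HomologicalComplex.homologyMap f n) := by
    rw [HomologicalComplex.epi_homologyMap_iff_up_to_refinements f (n + 1) n _ (by simp) rfl]
    intro T z hz
    obtain ⟨T', π, hπ, x, hx⟩ := (S n).surj z hz
    refine ⟨T', π, hπ, x ≫ (S n).i, ?_, 0, ?_⟩
    · rw [Category.assoc, hcyc, comp_zero]
    · rw [hx, hf]; simp
  exact isIso_of_mono_of_epi _

theorem exists_cochain
    (hpull : ∀ ⦃X Y W : C⦄ (f : X ⟶ W) (g : Y ⟶ W), N X → N Y → N (pullback f g))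
    (hker : ∀ ⦃X Y : C⦄ (f : X ⟶ Y), N X → N (kernel f))
    (hPN : ∀ X, P X → N X)
    (hcov : ∀ X, N X → ∃ (Y : C) (_ : P Y) (p : Y ⟶ X), Epi p)
    (hP0 : ∀ X, IsZero X → P X) (hPiso : ∀ X Y, (X ≅ Y) → P X → P Y)
    (Z : CochainComplex C ℤ) (b : ℤ) (hb : ∀ m, b < m → IsZero (Z.X m))
    (hZ : ∀ n, N (Z.X n)) :
    ∃ (Q : CochainComplex C ℤ) (_ : ∀ m, b < m → IsZero (Q.X m)) (_ : ∀ m, P (Q.X m))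
      (f : Q ⟶ Z), QuasiIso f := by
  let e := ComplexShape.embeddingUpIntLE b
  obtain ⟨Q, f, hQ, hf⟩ := exists_chain hpull hker hPN hcov (Z := Z.restriction e)
    (fun n => hZ _)
  let g : Z ⟶ (Z.restriction e).extend e := e.liftExtend (𝟙 _)
    (fun j hj => hj.false_of_isTruncLE.elim)
  have hz : ∀ m, b < m → ∀ L : ChainComplex C ℕ, IsZero ((L.extend e).X m) := fun m hm L =>
    L.isZero_extend_X e m ((ComplexShape.notMem_range_embeddingUpIntLE_iff b m).2 hm)
  have hg : ∀ m, IsIso (g.f m) := by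
    intro m
    by_cases hm : b < m
    · exact isIso_of_source_target_iso_zero _ (hb m hm).isoZero (hz m hm _).isoZero
    · have hm' := mt (ComplexShape.notMem_range_embeddingUpIntLE_iff b m).1 hm
      push Not at hm'
      obtain ⟨i, hi⟩ := hm'
      refine (e.isIso_liftExtend_f_iff _ _ hi).2 ?_
      rw [HomologicalComplex.id_f]; infer_instance
  have : IsIso g := HomologicalComplex.Hom.isIso_of_components g
  refine ⟨Q.extend e, fun m hm => hz m hm _, fun m => ?_,
    HomologicalComplex.extendMap f e ≫ inv g, inferInstance⟩
  by_cases hm : b < m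
  · exact hP0 _ (hz m hm _)
  · have hm' := mt (ComplexShape.notMem_range_embeddingUpIntLE_iff b m).1 hm
    push Not at hm'
    obtain ⟨i, hi⟩ := hm'
    exact hPiso _ _ (Q.extendXIso e hi).symm (hQ i)

end Abstract

section Concrete

universe w

variable {R : Type} [CommRing R] {A : Type} [PartialOrder A]

/-- Indexing set of the free cover. -/
abbrev T (n : A → ℕ) (b : A) : Type := Σ a : {a : A // a ≤ b}, Fin (n a)

/-- Transition maps of the indexing sets. -/
def T.map (n : A → ℕ) {b c : A} (h : b ≤ c) (x : T n b) : T n c :=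
  ⟨⟨x.1, x.1.2.trans h⟩, x.2⟩

/-- The free functor on the indexing sets. -/
noncomputable def freeFunctor (R : Type) [CommRing R] (n : A → ℕ) : A ⥤ ModuleCat.{w} R where
  obj b := ModuleCat.of R (ULift.{w} (T n b →₀ R))
  map {b c} h := ModuleCat.ofHom (ULift.moduleEquiv.symm.toLinearMap ∘ₗ
    Finsupp.lmapDomain R R (T.map n (leOfHom h)) ∘ₗ ULift.moduleEquiv.toLinearMap)
  map_id b := by
    have : T.map n (le_refl b) = id := rfl
    ext x : 2
    simp [this, Finsupp.lmapDomain_id]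
  map_comp {b c d} f g := by
    have : T.map n (leOfHom (f ≫ g)) = T.map n (leOfHom g) ∘ T.map n (leOfHom f) := rfl
    ext x : 2
    simp [this, Finsupp.mapDomain_comp]

theorem exists_cover [Finite A] (F : A ⥤ ModuleCat.{w} R) (hF : ∀ a, Module.Finite R (F.obj a)) :
    ∃ (Q : A ⥤ ModuleCat.{w} R) (_ : ∀ a, Module.Finite R (Q.obj a) ∧ Module.Projective R (Q.obj a))
      (p : Q ⟶ F), Epi p := by
  choose n s hs using fun a => (Module.Finite.exists_fin (R := R) (M := F.obj a))
  let v : ∀ b, T n b → F.obj b := fun b x => (F.map (homOfLE x.1.2)).hom (s x.1 x.2)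
  have hv : ∀ {b c} (h : b ⟶ c) x, v c (T.map n (leOfHom h) x) = (F.map h).hom (v b x) := by
    intro b c h x
    have : F.map (homOfLE (T.map n (leOfHom h) x).1.2) = F.map (homOfLE x.1.2) ≫ F.map h := by
      rw [← F.map_comp]; rfl
    exact congrArg (fun t => t.hom (s x.1 x.2)) this
  refine ⟨freeFunctor R n, ?_, 
    { app := fun b => ModuleCat.ofHom
        (Finsupp.linearCombination R (v b) ∘ₗ ULift.moduleEquiv.toLinearMap), naturality := ?_ }, ?_⟩
  · intro a
    exact ⟨Module.Finite.equiv (ULift.moduleEquiv (R := R) (M := T n a →₀ R)).symm,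
      Module.Projective.of_equiv (ULift.moduleEquiv (R := R) (M := T n a →₀ R)).symm⟩
  · intro b c h
    apply ModuleCat.hom_ext
    have key : Finsupp.linearCombination R (v c) ∘ₗ Finsupp.lmapDomain R R (T.map n (leOfHom h)) =
        (F.map h).hom ∘ₗ Finsupp.linearCombination R (v b) := by
      apply Finsupp.lhom_ext
      intro x r
      rw [LinearMap.comp_apply, LinearMap.comp_apply, Finsupp.lmapDomain_apply,
        Finsupp.mapDomain_single, Finsupp.linearCombination_single,
        Finsupp.linearCombination_single, hv, map_smul]
    refine LinearMap.ext fun x => ?_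
    exact congrArg (fun t => t x.down) key
  · rw [NatTrans.epi_iff_epi_app]
    intro b
    rw [ModuleCat.epi_iff_range_eq_top, eq_top_iff, ← hs b, Submodule.span_le]
    rintro _ ⟨i, rfl⟩
    refine ⟨ULift.up (Finsupp.single (⟨⟨b, le_rfl⟩, i⟩ : T n b) 1), ?_⟩
    change Finsupp.linearCombination R (v b) (Finsupp.single _ 1) = _
    rw [Finsupp.linearCombination_single, one_smul]
    change (F.map (𝟙 b)).hom (s b i) = s b i
    simp

end Concrete


universe w

theorem main
    (R : Type) [CommRing R] [IsNoetherianRing R]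
    (A : Type) [PartialOrder A] [Fintype A]
    (Z : CochainComplex (A ⥤ ModuleCat.{w} R) ℤ)
    (hZbdd : ∃ a b : ℤ, ∀ m : ℤ, (m < a ∨ b < m) → IsZero (Z.X m))
    (hZfin : ∀ (m : ℤ) (a : A), Module.Finite R ((Z.X m).obj a)) :
    ∃ (Q : CochainComplex (A ⥤ ModuleCat.{w} R) ℤ)
      (_ : ∃ b : ℤ, ∀ m : ℤ, b < m → IsZero (Q.X m))
      (_ : ∀ (m : ℤ) (a : A), Module.Finite R ((Q.X m).obj a) ∧
            Module.Projective R ((Q.X m).obj a))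
      (f : Q ⟶ Z), ∀ a : A,
        QuasiIso ((((evaluation A (ModuleCat.{w} R)).obj a).mapHomologicalComplex
          (ComplexShape.up ℤ)).map f) := by
  obtain ⟨_, b, hb⟩ := hZbdd
  have hmono : ∀ {X Y : A ⥤ ModuleCat.{w} R} (f : X ⟶ Y) [Mono f],
      (∀ a, Module.Finite R (Y.obj a)) → ∀ a, Module.Finite R (X.obj a) := by
    intro X Y f _ hY a
    have := hY a
    exact Module.Finite.of_injective (f.app a).hom
      ((ModuleCat.mono_iff_injective _).1 inferInstance)
  obtain ⟨Q, hQ0, hQ, f, hf⟩ := PtwiseRes.exists_cochain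
    (N := fun F : A ⥤ ModuleCat.{w} R => ∀ a, Module.Finite R (F.obj a))
    (P := fun F : A ⥤ ModuleCat.{w} R => ∀ a, Module.Finite R (F.obj a) ∧ Module.Projective R (F.obj a))
    (by
      intro X Y W f g hX hY a
      have := hX a
      have := hY a
      let φ : (pullback f g).obj a →ₗ[R] X.obj a × Y.obj a :=
        LinearMap.prod ((pullback.fst f g).app a).hom ((pullback.snd f g).app a).hom
      refine Module.Finite.of_injective φ ?_
      have hpb := (IsPullback.of_hasPullback f g).map ((evaluation A (ModuleCat.{w} R)).obj a)
      rw [← LinearMap.ker_eq_bot, LinearMap.ker_eq_bot']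
      intro m hm
      have h1 : ((pullback.fst f g).app a).hom m = 0 := congrArg Prod.fst hm
      have h2 : ((pullback.snd f g).app a).hom m = 0 := congrArg Prod.snd hm
      have : ModuleCat.ofHom ((LinearMap.toSpanSingleton R ((pullback f g).obj a) m) ∘ₗ
          (ULift.moduleEquiv.{0, 0, w} (R := R) (M := R)).toLinearMap) = 0 := by
        apply hpb.hom_ext
        · rw [zero_comp]
          refine ModuleCat.hom_ext (LinearMap.ext fun r => ?_)
          change ((pullback.fst f g).app a).hom (r.down • m) = 0
          rw [map_smul, h1, smul_zero]
        · rw [zero_comp]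
          refine ModuleCat.hom_ext (LinearMap.ext fun r => ?_)
          change ((pullback.snd f g).app a).hom (r.down • m) = 0
          rw [map_smul, h2, smul_zero]
      have := congrArg (fun t => t.hom (ULift.up (1 : R))) this
      simpa using this)
    (fun X Y f hX => hmono (kernel.ι f) hX)
    (fun X hX a => (hX a).1)
    (fun X hX => PtwiseRes.exists_cover X hX)
    (by
      intro X hX a
      have : IsZero (X.obj a) := hX.obj a
      have := ModuleCat.subsingleton_of_isZero this
      exact ⟨Module.Finite.of_finite, Module.Projective.of_free⟩)
    (by
      intro X Y i hX a
      have := (hX a).1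
      have := (hX a).2
      exact ⟨Module.Finite.equiv (i.app a).toLinearEquiv,
        Module.Projective.of_equiv (i.app a).toLinearEquiv⟩)
    Z b (fun m hm => hb m (Or.inr hm)) hZfin
  exact ⟨Q, ⟨b, hQ0⟩, hQ, f, fun a => inferInstance⟩

end PtwiseRes

/-- Let `R` be a commutative noetherian ring and `A` a finite partially
ordered set, regarded as a category.  For every bounded cochain complex `Z` in the functor
category `A ⥤ Mod R` all of whose values are finitely generated `R`-modules, there exist a
bounded above cochain complex `Q` in `A ⥤ Mod R` all of whose values are finitely generated
projective `R`-modules and a pointwise quasi-isomorphism `Q ⟶ Z`. -/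
theorem exists_pointwise_finite_projective_resolution
    (R : Type) [CommRing R] [IsNoetherianRing R]
    (A : Type) [PartialOrder A] [Fintype A]
    (Z : CochainComplex (A ⥤ ModuleCat R) ℤ)
    (hZbdd : ∃ a b : ℤ, ∀ m : ℤ, (m < a ∨ b < m) → IsZero (Z.X m))
    (hZfin : ∀ (m : ℤ) (a : A), Module.Finite R ((Z.X m).obj a)) :
    ∃ (Q : CochainComplex (A ⥤ ModuleCat R) ℤ)
      (_ : ∃ b : ℤ, ∀ m : ℤ, b < m → IsZero (Q.X m))
      (_ : ∀ (m : ℤ) (a : A), Module.Finite R ((Q.X m).obj a) ∧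
            Module.Projective R ((Q.X m).obj a))
      (f : Q ⟶ Z), ∀ a : A,
        QuasiIso ((((evaluation A (ModuleCat R)).obj a).mapHomologicalComplex
          (ComplexShape.up ℤ)).map f) := by
  exact PtwiseRes.main R A Z hZbdd hZfin
end
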